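/- Let X be a compact metric space and let F be a nonempty family of functions f : X → ℝ such that 0 ≤ f(x) for all f ∈ F and x ∈ X, and every f ∈ F is Lipschitz with constant L ≥ 0. Then for any two Borel probability measures μ and ν on X: |⨅_{f ∈ F} ∫_X f dμ − ⨅_{f ∈ F} ∫_X f dν| ≤ L · sup { |∫_X h dμ − ∫_X h dν| : h : X → ℝ is Lipschitz with constant 1 }, i.e. the KL-criterion is Lipschitz with constant L with respect to the Kantorovich–Wasserstein distance in its dual (Kantorovich–Rubinstein) form. -/

import Mathlib

open MeasureTheory

theorem abs_ciInf_sub_ciInf_le {ι : Type*} [Nonempty ι] {a b : ι → ℝ} {C : ℝ}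
    (ha : BddBelow (Set.range a)) (hb : BddBelow (Set.range b)) (h : ∀ i, |a i - b i| ≤ C) :
    |(⨅ i, a i) - ⨅ i, b i| ≤ C := by
  have hab : (⨅ i, a i) - C ≤ ⨅ i, b i := le_ciInf fun i => by
    linarith [ciInf_le ha i, (abs_le.1 (h i)).2]
  have hba : (⨅ i, b i) - C ≤ ⨅ i, a i := le_ciInf fun i => by
    linarith [ciInf_le hb i, (abs_le.1 (h i)).1]
  exact abs_le.2 ⟨by linarith, by linarith⟩

section Kantorovich

variable {X : Type*} [MetricSpace X] [CompactSpace X] [MeasurableSpace X] [BorelSpace X]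

theorem LipschitzWith.abs_integral_sub_apply_le {K : NNReal} {f : X → ℝ} (hf : LipschitzWith K f)
    (μ : Measure X) [IsProbabilityMeasure μ] (x₀ : X) :
    |(∫ x, f x ∂μ) - f x₀| ≤ K * Metric.diam (Set.univ : Set X) := by
  have hint : Integrable f μ :=
    hf.continuous.integrable_of_hasCompactSupport (HasCompactSupport.of_compactSpace f)
  have hsub : (∫ x, f x ∂μ) - f x₀ = ∫ x, (f x - f x₀) ∂μ := by
    rw [integral_sub hint (integrable_const _)]
    simp
  have hle := norm_integral_le_of_norm_le_const (μ := μ) (f := fun x => f x - f x₀)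
    (C := K * Metric.diam (Set.univ : Set X)) (Filter.Eventually.of_forall fun x => by
      rw [← dist_eq_norm]
      exact (hf.dist_le_mul x x₀).trans (mul_le_mul_of_nonneg_left
        (Metric.dist_le_diam_of_mem isCompact_univ.isBounded (Set.mem_univ x) (Set.mem_univ x₀))
        K.coe_nonneg))
  rw [hsub]
  simpa using hle

theorem bddAbove_abs_integral_sub_integral (μ ν : Measure X) [IsProbabilityMeasure μ]
    [IsProbabilityMeasure ν] :
    BddAbove {r : ℝ | ∃ h : X → ℝ, LipschitzWith 1 h ∧
      r = |(∫ x, h x ∂μ) - ∫ x, h x ∂ν|} := by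
  obtain ⟨x₀⟩ := nonempty_of_isProbabilityMeasure μ
  refine ⟨2 * Metric.diam (Set.univ : Set X), ?_⟩
  rintro r ⟨h, hh, rfl⟩
  have hμ := abs_le.1 (hh.abs_integral_sub_apply_le μ x₀)
  have hν := abs_le.1 (hh.abs_integral_sub_apply_le ν x₀)
  simp only [NNReal.coe_one, one_mul] at hμ hν
  exact abs_le.2 ⟨by linarith, by linarith⟩

theorem LipschitzWith.abs_integral_sub_integral_le {K : NNReal} {f : X → ℝ}
    (hf : LipschitzWith K f) (μ ν : Measure X) [IsProbabilityMeasure μ]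
    [IsProbabilityMeasure ν] :
    |(∫ x, f x ∂μ) - ∫ x, f x ∂ν| ≤
      K * sSup {r : ℝ | ∃ h : X → ℝ, LipschitzWith 1 h ∧
        r = |(∫ x, h x ∂μ) - ∫ x, h x ∂ν|} := by
  rcases eq_or_ne K 0 with rfl | hK
  · obtain ⟨x₀⟩ := nonempty_of_isProbabilityMeasure μ
    have hμ := hf.abs_integral_sub_apply_le μ x₀
    have hν := hf.abs_integral_sub_apply_le ν x₀
    simp only [NNReal.coe_zero, zero_mul, abs_nonpos_iff, sub_eq_zero] at hμ hν ⊢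
    rw [hμ, hν]
  · have hK' : (0 : ℝ) < K := NNReal.coe_pos.2 (pos_iff_ne_zero.2 hK)
    have hlip : LipschitzWith 1 fun x => (K : ℝ)⁻¹ * f x :=
      LipschitzWith.of_dist_le_mul fun x y => by
        rw [Real.dist_eq, ← mul_sub, abs_mul, abs_of_pos (inv_pos.2 hK'), ← Real.dist_eq,
          NNReal.coe_one, one_mul, inv_mul_le_iff₀ hK']
        exact hf.dist_le_mul x y
    have hle := le_csSup (bddAbove_abs_integral_sub_integral μ ν) ⟨_, hlip, rfl⟩
    rwa [integral_const_mul, integral_const_mul, ← mul_sub, abs_mul,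
      abs_of_pos (inv_pos.2 hK'), inv_mul_le_iff₀ hK'] at hle

end Kantorovich

/-- quantitative Lipschitz estimate for the KL-criterion with respect to the
Kantorovich–Wasserstein distance in its dual (Kantorovich–Rubinstein) form. -/
theorem kl_criterion_lipschitz
    {X : Type*} [MetricSpace X] [CompactSpace X] [MeasurableSpace X] [BorelSpace X]
    (F : Set (X → ℝ)) (hF : F.Nonempty) (L : ℝ) (hL : 0 ≤ L)
    (hnonneg : ∀ f ∈ F, ∀ x : X, 0 ≤ f x)
    (hlip : ∀ f ∈ F, LipschitzWith (Real.toNNReal L) f)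
    (μ ν : Measure X) [IsProbabilityMeasure μ] [IsProbabilityMeasure ν] :
    |(⨅ f : F, ∫ x, (f : X → ℝ) x ∂μ) - ⨅ f : F, ∫ x, (f : X → ℝ) x ∂ν| ≤
      L * sSup {r : ℝ | ∃ h : X → ℝ, LipschitzWith 1 h ∧
        r = |(∫ x, h x ∂μ) - ∫ x, h x ∂ν|} := by
  have : Nonempty F := hF.to_subtype
  have hbdd (ρ : Measure X) :
      BddBelow (Set.range fun f : F => ∫ x, (f : X → ℝ) x ∂ρ) := by
    refine ⟨0, ?_⟩
    rintro _ ⟨f, rfl⟩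
    exact integral_nonneg (hnonneg f f.2)
  refine abs_ciInf_sub_ciInf_le (hbdd μ) (hbdd ν) fun f => ?_
  simpa only [Real.coe_toNNReal L hL] using (hlip f f.2).abs_integral_sub_integral_le μ ν
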